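/- Suppose 0 < κ < ∞. Then lim_{x→∞} (1/H̄(x)) · ∫_{(x,∞)} F̄(s) μ_G(ds) = κ/(1+κ), where μ_G is the Lebesgue–Stieltjes measure of G. Equivalently, the tail of the distribution of a censored lifetime, P[T_1 > x | T*_1 > U_1] = (∫_{(x,∞)} F̄(s) μ_G(ds)) / (∫_{[0,∞)} F̄(s) μ_G(ds)), is asymptotically equivalent to κ·H̄(x)/((1+κ)·p_c) as x → ∞, where p_c = ∫_{[0,∞)} F̄(s) μ_G(ds). -/

import Mathlib

open Filter Real MeasureTheory

lemma rep_hasDerivAt (F f : ℝ → ℝ) (x₀ k : ℝ)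
    (hf_pos : ∀ x, x₀ ≤ x → 0 < f x)
    (hf_diff : ∀ x, x₀ ≤ x → DifferentiableAt ℝ f x)
    (hFrep : ∀ x, x₀ < x → 1 - F x = k * Real.exp (-∫ u in x₀..x, 1 / f u))
    (x : ℝ) (hx : x₀ < x) : HasDerivAt F ((1 - F x) / f x) x := by
  have hc : ∀ y, x₀ ≤ y → ContinuousAt (fun u => 1 / f u) y := fun y hy =>
    continuousAt_const.div (hf_diff y hy).continuousAt (hf_pos y hy).ne'
  have hint : IntervalIntegrable (fun u => 1 / f u) volume x₀ x := by
    apply ContinuousOn.intervalIntegrable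
    intro y hy
    rw [Set.uIcc_of_le hx.le] at hy
    exact (hc y hy.1).continuousWithinAt
  have hm : StronglyMeasurableAtFilter (fun u => 1 / f u) (nhds x) volume :=
    ContinuousOn.stronglyMeasurableAtFilter isOpen_Ioi
      (fun y hy => (hc y (le_of_lt hy)).continuousWithinAt) x hx
  have h1 := intervalIntegral.integral_hasDerivAt_right hint hm (hc x hx.le)
  have h2 := ((h1.neg.exp).const_mul k).const_sub 1
  have h3 : HasDerivAt F _ x := h2.congr_of_eventuallyEq (by
    filter_upwards [isOpen_Ioi.mem_nhds hx] with y hy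
    have := hFrep y hy
    simp only [Pi.neg_apply]
    linarith)
  convert h3 using 1
  rw [hFrep x hx]
  simp only [Pi.neg_apply]
  ring

lemma measure_Ioi_eq (G : ℝ → ℝ) (hGtop : Filter.Tendsto G Filter.atTop (nhds 1))
    (μG : Measure ℝ)
    (hμG : ∀ a b : ℝ, a ≤ b → μG (Set.Ioc a b) = ENNReal.ofReal (G b - G a)) (x : ℝ) :
    μG (Set.Ioi x) = ENNReal.ofReal (1 - G x) := by
  have hU : ⋃ b : ℝ, Set.Ioc x b = Set.Ioi x := Set.iUnion_Ioc_right x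
  have h1 : Tendsto (fun b : ℝ => μG (Set.Ioc x b)) atTop (nhds (μG (⋃ b : ℝ, Set.Ioc x b))) :=
    tendsto_measure_iUnion_atTop (fun a b hab => Set.Ioc_subset_Ioc_right hab)
  rw [hU] at h1
  refine tendsto_nhds_unique h1 ?_
  have h2 : Tendsto (fun b => ENNReal.ofReal (G b - G x)) atTop
      (nhds (ENNReal.ofReal (1 - G x))) :=
    ENNReal.tendsto_ofReal (hGtop.sub_const _)
  refine h2.congr' ?_
  filter_upwards [eventually_ge_atTop x] with b hb
  exact (hμG x b hb).symm

/-- under the von Mises representations and the balance condition `f/g → κ`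
with `0 < κ < ∞`, the censored-lifetime tail integral `∫_{(x,∞)} F̄ dμ_G` is asymptotic to
`κ H̄(x)/(1+κ)`, i.e. `(1/H̄(x)) ∫_{(x,∞)} F̄ dμ_G → κ/(1+κ)` as `x → ∞`, where `μ_G` is the
Lebesgue–Stieltjes measure of `G` and `H̄ = F̄ Ḡ`. -/
theorem censored_tail_asymptotics
    (F G : ℝ → ℝ) (x₀ k₁ k₂ κ : ℝ) (f g : ℝ → ℝ)
    (hx₀ : 0 ≤ x₀) (hk₁ : 0 < k₁) (hk₂ : 0 < k₂)
    (hFmono : Monotone F) (hGmono : Monotone G)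
    (hFcont : Continuous F) (hGcont : Continuous G)
    (hFneg : ∀ x, x < 0 → F x = 0) (hGneg : ∀ x, x < 0 → G x = 0)
    (hFtop : Filter.Tendsto F Filter.atTop (nhds 1))
    (hGtop : Filter.Tendsto G Filter.atTop (nhds 1))
    (hf_pos : ∀ x, x₀ ≤ x → 0 < f x) (hg_pos : ∀ x, x₀ ≤ x → 0 < g x)
    (hf_diff : ∀ x, x₀ ≤ x → DifferentiableAt ℝ f x)
    (hg_diff : ∀ x, x₀ ≤ x → DifferentiableAt ℝ g x)
    (hf' : Filter.Tendsto (deriv f) Filter.atTop (nhds 0))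
    (hg' : Filter.Tendsto (deriv g) Filter.atTop (nhds 0))
    (hFrep : ∀ x, x₀ < x → 1 - F x = k₁ * Real.exp (-∫ u in x₀..x, 1 / f u))
    (hGrep : ∀ x, x₀ < x → 1 - G x = k₂ * Real.exp (-∫ u in x₀..x, 1 / g u))
    (hκ : Filter.Tendsto (fun x => f x / g x) Filter.atTop (nhds κ)) (hκpos : 0 < κ)
    (μG : Measure ℝ)
    (hμG : ∀ a b : ℝ, a ≤ b → μG (Set.Ioc a b) = ENNReal.ofReal (G b - G a)) :
    Filter.Tendsto
      (fun x => (∫ s in Set.Ioi x, (1 - F s) ∂μG) / ((1 - F x) * (1 - G x)))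
      Filter.atTop (nhds (κ / (1 + κ))) := by
  have hF1 : ∀ x, F x ≤ 1 := fun x => hFmono.ge_of_tendsto hFtop x
  have hG1 : ∀ x, G x ≤ 1 := fun x => hGmono.ge_of_tendsto hGtop x
  have hF0 : ∀ x, 0 ≤ F x := fun x => by
    have h1 := hFneg (min x (-1)) (lt_of_le_of_lt (min_le_right _ _) (by norm_num))
    have h2 := hFmono (min_le_left x (-1))
    linarith
  have hIoi := measure_Ioi_eq G hGtop μG hμG
  have hfin : ∀ x, μG (Set.Ioi x) ≠ ⊤ := fun x => by rw [hIoi]; exact ENNReal.ofReal_ne_top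
  have hint : ∀ x, IntegrableOn (fun s => 1 - F s) (Set.Ioi x) μG := fun x => by
    refine Measure.integrableOn_of_bounded (M := 1) (hfin x)
      (continuous_const.sub hFcont).aestronglyMeasurable ?_
    refine Eventually.of_forall fun s => ?_
    rw [Real.norm_eq_abs, abs_le]
    constructor <;> linarith [hF1 s, hF0 s]
  set A : ℝ → ℝ := fun x => ∫ s in Set.Ioi x, (1 - F s) ∂μG with hA
  have hA0 : ∀ x, 0 ≤ A x := fun x =>
    integral_nonneg (fun s => by simpa using hF1 s)
  have hA1 : ∀ x, A x ≤ 1 - G x := fun x => by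
    have h := norm_setIntegral_le_of_norm_le_const (μ := μG) (s := Set.Ioi x)
      (f := fun s => 1 - F s) (C := 1) (hfin x).lt_top (fun s _ => by
        rw [Real.norm_eq_abs, abs_le]
        constructor <;> linarith [hF1 s, hF0 s])
    rw [Measure.real, hIoi, ENNReal.toReal_ofReal (by linarith [hG1 x]), one_mul] at h
    exact (le_abs_self _).trans h
  have hGb0 : Tendsto (fun x => 1 - G x) atTop (nhds 0) := by
    simpa using hGtop.const_sub 1
  have hFb0 : Tendsto (fun x => 1 - F x) atTop (nhds 0) := by
    simpa using hFtop.const_sub 1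
  have hAlim : Tendsto A atTop (nhds 0) :=
    squeeze_zero hA0 hA1 hGb0
  -- increments
  have hinc : ∀ x y, x ≤ y →
      (1 - F y) * (G y - G x) ≤ A x - A y ∧ A x - A y ≤ (1 - F x) * (G y - G x) := by
    intro x y hxy
    have hsplit : A x = (∫ s in Set.Ioc x y, (1 - F s) ∂μG) + A y := by
      simp only [hA]
      rw [← Set.Ioc_union_Ioi_eq_Ioi hxy]
      exact setIntegral_union Set.Ioc_disjoint_Ioi_same measurableSet_Ioi
        ((hint x).mono_set Set.Ioc_subset_Ioi_self) (hint y)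
    have hm : μG.real (Set.Ioc x y) = G y - G x := by
      rw [Measure.real, hμG x y hxy, ENNReal.toReal_ofReal (by linarith [hGmono hxy])]
    have hfi : μG (Set.Ioc x y) ≠ ⊤ := by rw [hμG x y hxy]; exact ENNReal.ofReal_ne_top
    have hc : ∀ c : ℝ, ∫ _ in Set.Ioc x y, c ∂μG = c * (G y - G x) := fun c => by
      rw [setIntegral_const, hm, smul_eq_mul, mul_comm]
    have hI := (hint x).mono_set (show Set.Ioc x y ⊆ Set.Ioi x from Set.Ioc_subset_Ioi_self)
    constructor
    · rw [← hc, hsplit, add_sub_cancel_right]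
      exact setIntegral_mono_on (integrableOn_const hfi) hI measurableSet_Ioc
        (fun s hs => by linarith [hFmono hs.2])
    · rw [← hc, hsplit, add_sub_cancel_right]
      exact setIntegral_mono_on hI (integrableOn_const hfi) measurableSet_Ioc
        (fun s hs => by linarith [hFmono hs.1.le])
  have hFd := rep_hasDerivAt F f x₀ k₁ hf_pos hf_diff hFrep
  have hGd := rep_hasDerivAt G g x₀ k₂ hg_pos hg_diff hGrep
  have hAd : ∀ x, x₀ < x → HasDerivAt A (-((1 - F x) * ((1 - G x) / g x))) x := by
    intro x hx
    have hB : HasDerivAt (fun y => A y + (1 - F x) * G y) 0 x := by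
      rw [hasDerivAt_iff_isLittleO]
      have hFo : (fun y => F y - F x) =o[nhds x] (fun _ => (1 : ℝ)) := by
        rw [Asymptotics.isLittleO_one_iff]
        simpa using (hFcont.tendsto x).sub_const (F x)
      have hGo : (fun y => G y - G x) =O[nhds x] (fun y => y - x) := (hGd x hx).isBigO_sub
      have hprod := hFo.mul_isBigO hGo
      simp only [one_mul] at hprod
      refine Asymptotics.IsBigO.trans_isLittleO (Asymptotics.IsBigO.of_bound 1 ?_) hprod
      refine Eventually.of_forall fun y => ?_
      simp only [smul_zero, sub_zero, one_mul, Real.norm_eq_abs]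
      rcases le_total x y with h | h
      · have h1 := hinc x y h
        have h2 := mul_nonneg (sub_nonneg.2 (hFmono h)) (sub_nonneg.2 (hGmono h))
        rw [abs_of_nonneg h2, abs_le]
        constructor <;> nlinarith
      · have h1 := hinc y x h
        have h2 := mul_nonneg (sub_nonneg.2 (hFmono h)) (sub_nonneg.2 (hGmono h))
        have h3 : (F y - F x) * (G y - G x) = (F x - F y) * (G x - G y) := by ring
        rw [h3, abs_of_nonneg h2, abs_le]
        constructor <;> nlinarith
    have h := hB.sub ((hGd x hx).const_mul (1 - F x))
    rw [zero_sub] at h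
    refine h.congr_of_eventuallyEq (Eventually.of_forall fun y => ?_)
    simp only [Pi.sub_apply]
    ring
  have hFp : ∀ x, x₀ < x → 0 < 1 - F x := fun x hx => by rw [hFrep x hx]; positivity
  have hGp : ∀ x, x₀ < x → 0 < 1 - G x := fun x hx => by rw [hGrep x hx]; positivity
  have hHd : ∀ x, x₀ < x → HasDerivAt (fun x => (1 - F x) * (1 - G x))
      (-((1 - F x) / f x) * (1 - G x) + (1 - F x) * -((1 - G x) / g x)) x := fun x hx =>
    ((hFd x hx).const_sub 1).mul ((hGd x hx).const_sub 1)
  refine HasDerivAt.lhopital_zero_atTop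
    ((eventually_gt_atTop x₀).mono hAd) ((eventually_gt_atTop x₀).mono hHd) ?_ hAlim ?_ ?_
  · filter_upwards [eventually_gt_atTop x₀] with x hx
    have a := hFp x hx
    have b := hGp x hx
    have c := hf_pos x hx.le
    have d := hg_pos x hx.le
    have e1 : 0 < (1 - F x) / f x * (1 - G x) := by positivity
    have e2 : 0 < (1 - F x) * ((1 - G x) / g x) := by positivity
    apply ne_of_lt
    linarith
  · simpa using hFb0.mul hGb0
  · have hl : Tendsto (fun x => (f x / g x) / (1 + f x / g x)) atTop (nhds (κ / (1 + κ))) :=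
      hκ.div (hκ.const_add 1) (by positivity)
    refine hl.congr' ?_
    filter_upwards [eventually_gt_atTop x₀] with x hx
    have a := hFp x hx
    have b := hGp x hx
    have c := hf_pos x hx.le
    have d := hg_pos x hx.le
    have e : -((1 - F x) / f x) * (1 - G x) + (1 - F x) * -((1 - G x) / g x)
        = -((1 - F x) * (1 - G x) * (f x + g x) / (f x * g x)) := by
      field_simp
      ring
    rw [e, neg_div_neg_eq]
    field_simp
    try ring
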